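/- arXiv:2010.15729 — 2 statements merged into one kernel-verified Lean document; each statement's English description precedes it below -/
import Mathlib

section
/- Uniform continuity of log-determinant mutual information: Let κ ≥ 1 and let V_AB, W_AB be real symmetric matrices with V_AB, W_AB ≥ κ^{-1} I. Then |I_M(A:B)_V − I_M(A:B)_W| ≤ κ log₂(e) ‖V_AB − W_AB‖₁, where ‖·‖₁ is the trace norm. -/
open Matrix Classical

/-- The log-determinant mutual information of a bipartite positive matrix. -/
noncomputable def IM {α β : Type*} [Fintype α] [Fintype β] [DecidableEq α] [DecidableEq β]
    (W : Matrix (α ⊕ β) (α ⊕ β) ℝ) : ℝ :=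
  (1/2) * Real.logb 2 ((W.toBlocks₁₁.det * W.toBlocks₂₂.det) / W.det)

/-- The trace norm of a (Hermitian) real matrix: the sum of the absolute values of its
eigenvalues. -/
noncomputable def traceNorm {n : Type*} [Fintype n] [DecidableEq n]
    (A : Matrix n n ℝ) : ℝ :=
  if h : A.IsHermitian then ∑ i, |h.eigenvalues i| else 0

theorem logdet_le_aux {n : Type*} [Fintype n] [DecidableEq n] (X : Matrix n n ℝ) (hX : X.PosDef) :
    Real.log X.det ≤ X.trace - (1 : Matrix n n ℝ).trace := by
  have h1 := hX.1.det_eq_prod_eigenvalues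
  have h2 := hX.1.trace_eq_sum_eigenvalues
  simp only [RCLike.ofReal_real_eq_id, id] at h1 h2
  rw [h1, h2, Real.log_prod (fun i _ => (hX.eigenvalues_pos i).ne'), Matrix.trace]
  rw [← Finset.sum_sub_distrib]
  refine Finset.sum_le_sum fun i _ => ?_
  simpa using Real.log_le_sub_one_of_pos (hX.eigenvalues_pos i)

open scoped MatrixOrder in
theorem logdet_sub_le {n : Type*} [Fintype n] [DecidableEq n] (M N : Matrix n n ℝ)
    (hM : M.PosDef) (hN : N.PosDef) :
    Real.log M.det - Real.log N.det ≤ (N⁻¹ * (M - N)).trace := by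
  obtain ⟨B, hB, hBN⟩ : ∃ B : Matrix n n ℝ, IsUnit B ∧ N = Bᴴ * B := by
    obtain ⟨B, hB⟩ := CStarAlgebra.nonneg_iff_eq_star_mul_self.mp
      (Matrix.nonneg_iff_posSemidef.mpr hN.posSemidef)
    refine ⟨B, ?_, hB⟩
    have h := hN.det_pos
    rw [hB, det_mul] at h
    exact (Matrix.isUnit_iff_isUnit_det B).mpr (isUnit_iff_ne_zero.mpr (right_ne_zero_of_mul h.ne'))
  have hBd : IsUnit B.det := (Matrix.isUnit_iff_isUnit_det B).mp hB
  have hX : ((B⁻¹)ᴴ * M * B⁻¹).PosDef := by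
    apply hM.conjTranspose_mul_mul_same
    apply Matrix.mulVec_injective_of_isUnit
    exact (Matrix.isUnit_nonsing_inv_iff).mpr hB
  have h := logdet_le_aux _ hX
  have hdet : ((B⁻¹)ᴴ * M * B⁻¹).det = M.det / N.det := by
    rw [hBN]
    simp [det_mul, Matrix.det_nonsing_inv]
    field_simp [hBd.ne_zero]
  have hNd : IsUnit N.det := isUnit_iff_ne_zero.mpr hN.det_pos.ne'
  have htr : ((B⁻¹)ᴴ * M * B⁻¹).trace = (N⁻¹ * M).trace := by
    rw [Matrix.trace_mul_comm, ← Matrix.mul_assoc, hBN, Matrix.mul_inv_rev,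
      Matrix.conjTranspose_nonsing_inv]
  rw [hdet, htr, Real.log_div hM.det_pos.ne' hN.det_pos.ne'] at h
  rwa [Matrix.mul_sub, Matrix.nonsing_inv_mul _ hNd, Matrix.trace_sub]

theorem trace_mul_le {n : Type*} [Fintype n] [DecidableEq n] (K D : Matrix n n ℝ) (κ : ℝ)
    (hD : D.IsHermitian) (hK : ∀ u : n → ℝ, |u ⬝ᵥ K *ᵥ u| ≤ κ * (u ⬝ᵥ u)) :
    (K * D).trace ≤ κ * traceNorm D := by
  rw [traceNorm, dif_pos hD, Finset.mul_sum]
  set U : Matrix n n ℝ := (hD.eigenvectorUnitary : Matrix n n ℝ) with hU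
  have hUU : star U * U = 1 := Unitary.coe_star_mul_self hD.eigenvectorUnitary
  have hs : D = U * diagonal hD.eigenvalues * star U := by
    have := hD.spectral_theorem
    simpa [Unitary.conjStarAlgAut_apply, Function.comp_def] using this
  have e : (K * D).trace = ((star U * K * U) * diagonal hD.eigenvalues).trace := by
    conv_lhs => rw [hs]
    rw [← Matrix.mul_assoc, ← Matrix.mul_assoc, Matrix.trace_mul_comm]
    simp only [Matrix.mul_assoc]
  rw [e, Matrix.trace]
  refine Finset.sum_le_sum fun i _ => ?_
  rw [diag_apply, Matrix.mul_diagonal]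
  have h1 : (star U * K * U) i i = (fun j => U j i) ⬝ᵥ K *ᵥ (fun j => U j i) := by
    rw [Matrix.mul_assoc]
    simp [Matrix.mul_apply, dotProduct, mulVec, star_apply]
  have h2 : (fun j => U j i) ⬝ᵥ (fun j => U j i) = 1 := by
    have := congrFun (congrFun hUU i) i
    simpa [Matrix.mul_apply, dotProduct, star_apply] using this
  have h3 := hK (fun j => U j i)
  rw [h2, ← h1, mul_one] at h3
  calc _ ≤ |(star U * K * U) i i * hD.eigenvalues i| := le_abs_self _
    _ ≤ _ := by rw [abs_mul]; gcongr

theorem quad_inv_le {n : Type*} [Fintype n] [DecidableEq n] (N : Matrix n n ℝ) (κ : ℝ)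
    (hκ : 0 < κ) (hN : N.PosDef) (h : (N - κ⁻¹ • (1 : Matrix n n ℝ)).PosSemidef) (u : n → ℝ) :
    |u ⬝ᵥ N⁻¹ *ᵥ u| ≤ κ * (u ⬝ᵥ u) := by
  have hNd : IsUnit N.det := isUnit_iff_ne_zero.mpr hN.det_pos.ne'
  set w := N⁻¹ *ᵥ u with hw
  have hu : N *ᵥ w = u := by
    rw [hw, Matrix.mulVec_mulVec, Matrix.mul_nonsing_inv _ hNd, Matrix.one_mulVec]
  have h1 := h.dotProduct_mulVec_nonneg w
  rw [Matrix.sub_mulVec, hu, Matrix.smul_mulVec, Matrix.one_mulVec, dotProduct_sub,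
    dotProduct_smul, star_trivial, dotProduct_comm, smul_eq_mul] at h1
  have h0 : 0 ≤ w ⬝ᵥ w := by
    simpa using dotProduct_star_self_nonneg w
  have h2 : 0 ≤ (κ • u - w) ⬝ᵥ (κ • u - w) := by
    simpa using dotProduct_star_self_nonneg (κ • u - w)
  simp only [sub_dotProduct, dotProduct_sub, smul_dotProduct, dotProduct_smul, smul_eq_mul] at h2
  rw [dotProduct_comm w u] at h2
  have h3 : w ⬝ᵥ w ≤ κ * (u ⬝ᵥ w) := by
    have := mul_nonneg hκ.le h1
    rw [mul_sub, ← mul_assoc, mul_inv_cancel₀ hκ.ne'] at this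
    linarith
  have h4 : 0 ≤ u ⬝ᵥ w := by
    have : 0 ≤ κ⁻¹ * (w ⬝ᵥ w) := mul_nonneg (inv_nonneg.mpr hκ.le) h0
    linarith
  rw [abs_of_nonneg h4]
  have : κ * (u ⬝ᵥ w) ≤ κ * (κ * (u ⬝ᵥ u)) := by nlinarith
  exact le_of_mul_le_mul_left this hκ

theorem posDef_of_ge {n : Type*} [Fintype n] [DecidableEq n] (N : Matrix n n ℝ) (κ : ℝ)
    (hκ : 0 < κ) (h : (N - κ⁻¹ • (1 : Matrix n n ℝ)).PosSemidef) : N.PosDef := by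
  have : (κ⁻¹ • (1 : Matrix n n ℝ)).PosDef := Matrix.PosDef.one.smul (inv_pos.mpr hκ)
  simpa using Matrix.PosDef.posSemidef_add h this

theorem traceNorm_neg_aux {n : Type*} [Fintype n] [DecidableEq n] (κ : ℝ) (hκ : 0 < κ)
    (V W : Matrix n n ℝ)
    (hV : (V - κ⁻¹ • (1 : Matrix n n ℝ)).PosSemidef)
    (hW : (W - κ⁻¹ • (1 : Matrix n n ℝ)).PosSemidef) :
    Real.log V.det - Real.log W.det ≤ κ * traceNorm (V - W) := by
  have pV := posDef_of_ge V κ hκ hV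
  have pW := posDef_of_ge W κ hκ hW
  exact (logdet_sub_le V W pV pW).trans
    (trace_mul_le _ _ κ (pV.1.sub pW.1) (quad_inv_le W κ hκ pW hW))

theorem blocks_aux {α β : Type*} [Fintype α] [Fintype β] [DecidableEq α] [DecidableEq β]
    (κ : ℝ) (V : Matrix (α ⊕ β) (α ⊕ β) ℝ)
    (hV : (V - κ⁻¹ • (1 : Matrix (α ⊕ β) (α ⊕ β) ℝ)).PosSemidef) :
    (V.toBlocks₁₁ - κ⁻¹ • (1 : Matrix α α ℝ)).PosSemidef ∧
    (V.toBlocks₂₂ - κ⁻¹ • (1 : Matrix β β ℝ)).PosSemidef := by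
  constructor
  · convert hV.submatrix (Sum.inl : α → α ⊕ β) using 1
    ext i j
    simp [toBlocks₁₁, Matrix.one_apply]
  · convert hV.submatrix (Sum.inr : β → α ⊕ β) using 1
    ext i j
    simp [toBlocks₂₂, Matrix.one_apply]

theorem pinch_aux {α β : Type*} [Fintype α] [Fintype β] [DecidableEq α] [DecidableEq β]
    (κ : ℝ) (hκ : 0 < κ) (V W : Matrix (α ⊕ β) (α ⊕ β) ℝ)
    (hV : (V - κ⁻¹ • (1 : Matrix (α ⊕ β) (α ⊕ β) ℝ)).PosSemidef)
    (hW : (W - κ⁻¹ • (1 : Matrix (α ⊕ β) (α ⊕ β) ℝ)).PosSemidef) :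
    (Real.log V.toBlocks₁₁.det + Real.log V.toBlocks₂₂.det)
      - (Real.log W.toBlocks₁₁.det + Real.log W.toBlocks₂₂.det) ≤ κ * traceNorm (V - W) := by
  have pV := posDef_of_ge V κ hκ hV
  have pW := posDef_of_ge W κ hκ hW
  obtain ⟨hV1, hV2⟩ := blocks_aux κ V hV
  obtain ⟨hW1, hW2⟩ := blocks_aux κ W hW
  have pV1 := posDef_of_ge _ κ hκ hV1
  have pV2 := posDef_of_ge _ κ hκ hV2
  have pW1 := posDef_of_ge _ κ hκ hW1
  have pW2 := posDef_of_ge _ κ hκ hW2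
  have a1 := logdet_sub_le _ _ pV1 pW1
  have a2 := logdet_sub_le _ _ pV2 pW2
  set K : Matrix (α ⊕ β) (α ⊕ β) ℝ :=
    fromBlocks (W.toBlocks₁₁)⁻¹ 0 0 (W.toBlocks₂₂)⁻¹ with hK
  have hb : ∀ u : α ⊕ β → ℝ, |u ⬝ᵥ K *ᵥ u| ≤ κ * (u ⬝ᵥ u) := by
    intro u
    have b1 := quad_inv_le _ κ hκ pW1 hW1 (u ∘ Sum.inl)
    have b2 := quad_inv_le _ κ hκ pW2 hW2 (u ∘ Sum.inr)
    have e1 : u ⬝ᵥ u = (u ∘ Sum.inl) ⬝ᵥ (u ∘ Sum.inl) + (u ∘ Sum.inr) ⬝ᵥ (u ∘ Sum.inr) := by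
      simp [dotProduct]
    have e2 : u ⬝ᵥ K *ᵥ u = (u ∘ Sum.inl) ⬝ᵥ (W.toBlocks₁₁)⁻¹ *ᵥ (u ∘ Sum.inl)
        + (u ∘ Sum.inr) ⬝ᵥ (W.toBlocks₂₂)⁻¹ *ᵥ (u ∘ Sum.inr) := by
      rw [hK, fromBlocks_mulVec]
      simp [dotProduct]
    rw [e1, e2, mul_add]
    exact (abs_add_le _ _).trans (add_le_add b1 b2)
  have h := trace_mul_le K (V - W) κ (pV.1.sub pW.1) hb
  have e : (K * (V - W)).trace = ((W.toBlocks₁₁)⁻¹ * (V.toBlocks₁₁ - W.toBlocks₁₁)).trace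
      + ((W.toBlocks₂₂)⁻¹ * (V.toBlocks₂₂ - W.toBlocks₂₂)).trace := by
    have : V - W = fromBlocks (V.toBlocks₁₁ - W.toBlocks₁₁) (V.toBlocks₁₂ - W.toBlocks₁₂)
        (V.toBlocks₂₁ - W.toBlocks₂₁) (V.toBlocks₂₂ - W.toBlocks₂₂) := by
      ext (i | i) (j | j) <;> rfl
    rw [this, hK, fromBlocks_multiply]
    simp [Matrix.trace, Fintype.sum_sum_type]
  linarith

theorem IM_eq_aux {α β : Type*} [Fintype α] [Fintype β] [DecidableEq α] [DecidableEq β]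
    (κ : ℝ) (hκ : 0 < κ) (V : Matrix (α ⊕ β) (α ⊕ β) ℝ)
    (hV : (V - κ⁻¹ • (1 : Matrix (α ⊕ β) (α ⊕ β) ℝ)).PosSemidef) :
    IM V = (1/2) * ((Real.log V.toBlocks₁₁.det + Real.log V.toBlocks₂₂.det - Real.log V.det)
      / Real.log 2) := by
  have pV := posDef_of_ge V κ hκ hV
  obtain ⟨hV1, hV2⟩ := blocks_aux κ V hV
  have pV1 := posDef_of_ge _ κ hκ hV1
  have pV2 := posDef_of_ge _ κ hκ hV2
  rw [IM, Real.logb, Real.log_div (mul_pos pV1.det_pos pV2.det_pos).ne' pV.det_pos.ne',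
    Real.log_mul pV1.det_pos.ne' pV2.det_pos.ne']

theorem IM_sub_le {α β : Type*} [Fintype α] [Fintype β] [DecidableEq α] [DecidableEq β]
    (κ : ℝ) (hκ : 0 < κ) (V W : Matrix (α ⊕ β) (α ⊕ β) ℝ)
    (hV : (V - κ⁻¹ • (1 : Matrix (α ⊕ β) (α ⊕ β) ℝ)).PosSemidef)
    (hW : (W - κ⁻¹ • (1 : Matrix (α ⊕ β) (α ⊕ β) ℝ)).PosSemidef) :
    IM V - IM W ≤ κ * Real.logb 2 (Real.exp 1) * ((traceNorm (V - W) + traceNorm (W - V)) / 2) := by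
  have h1 := pinch_aux κ hκ V W hV hW
  have h2 := traceNorm_neg_aux κ hκ W V hW hV
  rw [IM_eq_aux κ hκ V hV, IM_eq_aux κ hκ W hW, Real.logb, Real.log_exp]
  have hl : 0 < Real.log 2 := Real.log_pos (by norm_num)
  rw [← mul_sub, ← sub_div]
  have : (κ * (1 / Real.log 2) * ((traceNorm (V - W) + traceNorm (W - V)) / 2))
    = (1/2) * ((κ * traceNorm (V - W) + κ * traceNorm (W - V)) / Real.log 2) := by
    field_simp
  rw [this]
  gcongr
  linarith

theorem traceNorm_le_of_neg {n : Type*} [Fintype n] [DecidableEq n] (D : Matrix n n ℝ)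
    (hD : D.IsHermitian) : traceNorm (-D) ≤ traceNorm D := by
  have hD' : (-D).IsHermitian := hD.neg
  set U : Matrix n n ℝ := (hD'.eigenvectorUnitary : Matrix n n ℝ) with hU
  have hUU : star U * U = 1 := Unitary.coe_star_mul_self hD'.eigenvectorUnitary
  have hUU' : U * star U = 1 := Unitary.coe_mul_star_self hD'.eigenvectorUnitary
  have hs : -D = U * diagonal hD'.eigenvalues * star U := by
    have := hD'.spectral_theorem
    simpa [Unitary.conjStarAlgAut_apply, Function.comp_def] using this
  set s : n → ℝ := fun i => (SignType.sign (hD'.eigenvalues i) : ℝ) with hsd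
  have key := trace_mul_le (-(U * diagonal s * star U)) D 1 hD ?_
  · rw [one_mul] at key
    refine le_trans (le_of_eq ?_) key
    rw [traceNorm, dif_pos hD', Matrix.neg_mul, ← Matrix.mul_neg]
    conv_rhs => rw [hs]
    have : U * diagonal s * star U * (U * diagonal hD'.eigenvalues * star U)
        = U * (diagonal s * diagonal hD'.eigenvalues) * star U := by
      calc _ = U * diagonal s * (star U * U) * diagonal hD'.eigenvalues * star U := by
            simp only [Matrix.mul_assoc]
        _ = _ := by rw [hUU]; simp only [Matrix.mul_assoc, Matrix.one_mul]
    rw [this, Matrix.trace_mul_comm, ← Matrix.mul_assoc, hUU, Matrix.one_mul,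
      diagonal_mul_diagonal, trace_diagonal]
    refine Finset.sum_congr rfl fun i _ => ?_
    simp only [hsd]
    exact (sign_mul_self _).symm
  · intro u
    set w := star U *ᵥ u with hw
    have hwU : u ᵥ* U = w := by
      rw [hw, star_eq_conjTranspose, conjTranspose_eq_transpose_of_trivial, mulVec_transpose]
    have e1 : u ⬝ᵥ (U * diagonal s * star U) *ᵥ u = ∑ i, s i * (w i * w i) := by
      rw [← mulVec_mulVec, ← mulVec_mulVec, dotProduct_mulVec, hwU]
      simp only [dotProduct, mulVec_diagonal, ← hw]
      exact Finset.sum_congr rfl fun i _ => by ring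
    have e2 : u ⬝ᵥ u = ∑ i, w i * w i := by
      have : u = U *ᵥ w := by rw [hw, mulVec_mulVec, hUU', one_mulVec]
      conv_lhs => rw [this]
      rw [← this, this, dotProduct_mulVec, ← this, hwU]; rfl
    rw [neg_mulVec, dotProduct_neg, abs_neg, e1, e2, one_mul]
    refine (Finset.abs_sum_le_sum_abs _ _).trans (Finset.sum_le_sum fun i _ => ?_)
    rw [abs_mul, abs_mul_self]
    have : |s i| ≤ 1 := by
      simp only [hsd]
      rcases SignType.trichotomy (SignType.sign (hD'.eigenvalues i)) with h | h | h <;> simp [h]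
    exact mul_le_of_le_one_left (mul_self_nonneg _) this

/-- Uniform continuity of the log-determinant mutual information: for `κ ≥ 1` and
real symmetric `V, W ≥ κ⁻¹ 1`,
`|I_M(A:B)_V − I_M(A:B)_W| ≤ κ log₂(e) ‖V − W‖₁`. -/
theorem IM_uniform_continuity {α β : Type*} [Fintype α] [Fintype β]
    [DecidableEq α] [DecidableEq β]
    (κ : ℝ) (hκ : 1 ≤ κ)
    (V W : Matrix (α ⊕ β) (α ⊕ β) ℝ) (hVs : V.IsSymm) (hWs : W.IsSymm)
    (hV : (V - κ⁻¹ • (1 : Matrix (α ⊕ β) (α ⊕ β) ℝ)).PosSemidef)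
    (hW : (W - κ⁻¹ • (1 : Matrix (α ⊕ β) (α ⊕ β) ℝ)).PosSemidef) :
    |IM V - IM W| ≤ κ * Real.logb 2 (Real.exp 1) * traceNorm (V - W) := by
  have hk : 0 < κ := by linarith
  have pV := posDef_of_ge V κ hk hV
  have pW := posDef_of_ge W κ hk hW
  have h1 := IM_sub_le κ hk V W hV hW
  have h2 := IM_sub_le κ hk W V hW hV
  have e1 := traceNorm_le_of_neg (V - W) (pV.1.sub pW.1)
  rw [neg_sub] at e1
  have hl : 0 ≤ κ * Real.logb 2 (Real.exp 1) := by
    rw [Real.logb, Real.log_exp]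
    have hl : 0 < Real.log 2 := Real.log_pos (by norm_num)
    positivity
  have h3 : κ * Real.logb 2 (Real.exp 1) * ((traceNorm (V - W) + traceNorm (W - V)) / 2)
      ≤ κ * Real.logb 2 (Real.exp 1) * traceNorm (V - W) :=
    mul_le_mul_of_nonneg_left (by linarith) hl
  rw [add_comm (traceNorm (W - V))] at h2
  rw [abs_le]
  constructor <;> linarith
end

section
/- Williamson decompositions of a QCM in xp-form classified: Let D > 0 be an n × n diagonal matrix. A 2n × 2n symplectic matrix S is such that S [[D,0],[0,D]] S^T is in xp-form if and only if S = [[M^{-1},0],[0,M^T]] · H [[U,0],[0,U*]] H†, where M is an arbitrary invertible n × n real matrix, H = (1/√2)[[1,1],[i,−i]] (block form with identity blocks), and U is a unitary commuting with D. -/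
open Matrix

/-- The standard symplectic form on `n` modes, in the `x|p` block representation. -/
noncomputable def Omg (n : ℕ) : Matrix (Fin n ⊕ Fin n) (Fin n ⊕ Fin n) ℝ :=
  fromBlocks 0 1 (-1) 0

/-- The unitary `H = (1/√2)[[1,1],[i·1,−i·1]]` diagonalising the symplectic form. -/
noncomputable def Hmat (n : ℕ) : Matrix (Fin n ⊕ Fin n) (Fin n ⊕ Fin n) ℂ :=
  (((Real.sqrt 2 : ℝ) : ℂ))⁻¹ •
    fromBlocks 1 1 (Complex.I • 1) (-(Complex.I • (1 : Matrix (Fin n) (Fin n) ℂ)))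


theorem wx_orth {n : ℕ} (Q : Matrix (Fin n) (Fin n) ℝ) (hQ : Qᵀ = Q) (e : Fin n → ℝ)
    (h : Q.charpoly = (Matrix.diagonal e).charpoly) :
    ∃ O : Matrix (Fin n) (Fin n) ℝ, O * Oᵀ = 1 ∧ Q = O * Matrix.diagonal e * Oᵀ := by
  have h1 : Q.IsHermitian := by rw [Matrix.IsHermitian, conjTranspose_eq_transpose_of_trivial, hQ]
  have h2 : (Matrix.diagonal e).IsHermitian := by
    rw [Matrix.IsHermitian, conjTranspose_eq_transpose_of_trivial, diagonal_transpose]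
  have h3 := (Matrix.IsHermitian.eigenvalues_eq_eigenvalues_iff h1 h2).2 h
  have s1 := h1.spectral_theorem
  have s2 := h2.spectral_theorem
  rw [h3] at s1
  simp only [Unitary.conjStarAlgAut_apply] at s1 s2
  have a1 := Unitary.coe_mul_star_self h1.eigenvectorUnitary
  have a2 := Unitary.coe_star_mul_self h1.eigenvectorUnitary
  have b1 := Unitary.coe_mul_star_self h2.eigenvectorUnitary
  have b2 := Unitary.coe_star_mul_self h2.eigenvectorUnitary
  set V : Matrix (Fin n) (Fin n) ℝ := (h1.eigenvectorUnitary : Matrix (Fin n) (Fin n) ℝ)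
  set W : Matrix (Fin n) (Fin n) ℝ := (h2.eigenvectorUnitary : Matrix (Fin n) (Fin n) ℝ)
  simp only [Unitary.coe_star, star_eq_conjTranspose,
    conjTranspose_eq_transpose_of_trivial] at s1 s2 a1 a2 b1 b2
  refine ⟨V * Wᵀ, ?_, ?_⟩
  · rw [transpose_mul, transpose_transpose]
    calc V * Wᵀ * (W * Vᵀ) = V * (Wᵀ * W) * Vᵀ := by noncomm_ring
      _ = 1 := by rw [b2, mul_one, a1]
  · rw [transpose_mul, transpose_transpose]
    set Λ := Matrix.diagonal (RCLike.ofReal ∘ h2.eigenvalues : Fin n → ℝ)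
    calc Q = V * Λ * Vᵀ := s1
      _ = V * (Wᵀ * W) * Λ * (Wᵀ * W) * Vᵀ := by rw [b2, mul_one, mul_one]
      _ = V * Wᵀ * (W * Λ * Wᵀ) * (W * Vᵀ) := by noncomm_ring
      _ = _ := by rw [← s2]

theorem wx_fact {n : ℕ} (X : Matrix (Fin n) (Fin n) ℝ) (hX : X.PosDef) :
    ∃ R : Matrix (Fin n) (Fin n) ℝ, IsUnit R.det ∧ X = R * Rᵀ := by
  open scoped MatrixOrder in
  obtain ⟨B, hB⟩ := CStarAlgebra.nonneg_iff_eq_star_mul_self.mp hX.posSemidef.nonneg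
  rw [star_eq_conjTranspose] at hB
  rw [conjTranspose_eq_transpose_of_trivial] at hB
  refine ⟨Bᵀ, ?_, by simpa using hB⟩
  have := hX.det_pos
  rw [hB, det_mul] at this
  exact isUnit_iff_ne_zero.2 (left_ne_zero_of_mul this.ne')

theorem wx_charpoly {n : ℕ} (P X : Matrix (Fin n) (Fin n) ℝ) (E : Matrix (Fin n) (Fin n) ℝ)
    (T T' : Matrix (Fin n ⊕ Fin n) (Fin n ⊕ Fin n) ℝ) (hT : T' * T = 1)
    (h : fromBlocks (P * X) 0 0 (X * P) = T * fromBlocks E 0 0 E * T') :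
    (P * X).charpoly = E.charpoly := by
  have h1 := congrArg Matrix.charpoly h
  rw [charpoly_mul_comm, ← mul_assoc, hT, one_mul, charpoly_fromBlocks_zero₁₂,
    charpoly_fromBlocks_zero₁₂, charpoly_mul_comm X P, ← sq, ← sq,
    sq_eq_sq_iff_eq_or_eq_neg] at h1
  rcases h1 with h1 | h1
  · exact h1
  · exfalso
    have a := (charpoly_monic (P * X)).leadingCoeff
    rw [h1, Polynomial.leadingCoeff_neg, (charpoly_monic E).leadingCoeff] at a
    norm_num at a

theorem wx_H {n : ℕ} (A B : Matrix (Fin n) (Fin n) ℝ) :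
    Hmat n * fromBlocks (A.map Complex.ofReal + Complex.I • B.map Complex.ofReal) 0 0
      ((A.map Complex.ofReal + Complex.I • B.map Complex.ofReal).map (starRingEnd ℂ)) * (Hmat n)ᴴ
      = (fromBlocks A B (-B) A).map Complex.ofReal := by
  have e : (A.map Complex.ofReal + Complex.I • B.map Complex.ofReal).map (starRingEnd ℂ)
      = A.map Complex.ofReal - Complex.I • B.map Complex.ofReal := by
    ext i j
    simp [sub_eq_add_neg]
  have c : (((Real.sqrt 2 : ℝ) : ℂ))⁻¹ * (((Real.sqrt 2 : ℝ) : ℂ))⁻¹ = 1 / 2 := by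
    rw [← mul_inv, ← Complex.ofReal_mul, Real.mul_self_sqrt (by norm_num)]
    norm_num
  rw [e, Hmat, conjTranspose_smul, fromBlocks_conjTranspose]
  simp only [smul_mul_assoc, mul_smul_comm, smul_smul, star_inv₀, RCLike.star_def,
    Complex.conj_ofReal, fromBlocks_multiply, fromBlocks_map, fromBlocks_smul]
  congr 1 <;> ext i j <;> simp <;> ring_nf <;> simp <;> ring_nf <;>
    rw [pow_two, c] <;> ring

theorem wx_U {n : ℕ} (A B : Matrix (Fin n) (Fin n) ℝ) :
    (A.map Complex.ofReal + Complex.I • B.map Complex.ofReal) ∈ Matrix.unitaryGroup (Fin n) ℂ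
    ↔ A * Aᵀ + B * Bᵀ = 1 ∧ B * Aᵀ - A * Bᵀ = 0 := by
  have e : (A.map Complex.ofReal + Complex.I • B.map Complex.ofReal) *
      star (A.map Complex.ofReal + Complex.I • B.map Complex.ofReal) =
      (A * Aᵀ + B * Bᵀ).map Complex.ofReal + Complex.I • (B * Aᵀ - A * Bᵀ).map Complex.ofReal := by
    ext i j
    simp only [mul_apply, star_apply, Matrix.add_apply, Matrix.sub_apply, map_apply,
      Matrix.smul_apply, transpose_apply]
    push_cast
    rw [← Finset.sum_add_distrib, ← Finset.sum_sub_distrib, smul_eq_mul, Finset.mul_sum,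
      ← Finset.sum_add_distrib]
    refine Finset.sum_congr rfl fun k _ => ?_
    simp
    linear_combination (-(B i k : ℂ) * B j k) * Complex.I_mul_I
  rw [Matrix.mem_unitaryGroup_iff, e]
  constructor
  · intro h
    constructor <;> ext i j
    · have := congrArg Complex.re (congrFun (congrFun h i) j)
      by_cases hij : i = j <;> simpa [one_apply, hij] using this
    · have := congrArg Complex.im (congrFun (congrFun h i) j)
      by_cases hij : i = j <;> simpa [one_apply, hij] using this
  · rintro ⟨h1, h2⟩
    rw [h1, h2]
    ext i j
    by_cases hij : i = j <;> simp [one_apply, hij]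

theorem wx_comm {n : ℕ} (A B D : Matrix (Fin n) (Fin n) ℝ) :
    (A.map Complex.ofReal + Complex.I • B.map Complex.ofReal) * D.map Complex.ofReal
     = D.map Complex.ofReal * (A.map Complex.ofReal + Complex.I • B.map Complex.ofReal)
    ↔ A * D = D * A ∧ B * D = D * B := by
  have e1 : (A.map Complex.ofReal + Complex.I • B.map Complex.ofReal) * D.map Complex.ofReal =
      (A * D).map Complex.ofReal + Complex.I • (B * D).map Complex.ofReal := by
    ext i j
    simp [mul_apply, Finset.mul_sum, ← Finset.sum_add_distrib]
    refine Finset.sum_congr rfl fun k _ => by ring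
  have e2 : D.map Complex.ofReal * (A.map Complex.ofReal + Complex.I • B.map Complex.ofReal) =
      (D * A).map Complex.ofReal + Complex.I • (D * B).map Complex.ofReal := by
    ext i j
    simp [mul_apply, Finset.mul_sum, ← Finset.sum_add_distrib]
    refine Finset.sum_congr rfl fun k _ => by ring
  rw [e1, e2]
  constructor
  · intro h
    constructor <;> ext i j
    · have := congrArg Complex.re (congrFun (congrFun h i) j)
      simpa using this
    · have := congrArg Complex.im (congrFun (congrFun h i) j)
      simpa using this
  · rintro ⟨h1, h2⟩
    rw [h1, h2]

theorem wx_M {n : ℕ} (d : Fin n → ℝ) (hd : ∀ i, 0 < d i) (X P : Matrix (Fin n) (Fin n) ℝ)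
    (hX : X.PosDef) (hP : Pᵀ = P)
    (h : (P * X).charpoly = (Matrix.diagonal (fun i => d i * d i)).charpoly) :
    ∃ M N : Matrix (Fin n) (Fin n) ℝ, M * N = 1 ∧ M * X * Mᵀ = Matrix.diagonal d ∧
      Nᵀ * P * N = Matrix.diagonal d := by
  obtain ⟨R, hR, rfl⟩ := wx_fact X hX
  obtain ⟨O, hO, hQ⟩ := wx_orth (Rᵀ * P * R) (by simp [hP, mul_assoc]) (fun i => d i * d i)
    (by rw [← h, charpoly_mul_comm (Rᵀ * P), ← mul_assoc, charpoly_mul_comm])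
  have hO' : Oᵀ * O = 1 := mul_eq_one_comm.1 hO
  have r1 : R⁻¹ * R = 1 := nonsing_inv_mul R hR
  have r2 : Rᵀ * (R⁻¹)ᵀ = 1 := by rw [← transpose_mul, r1, transpose_one]
  have q : ∀ i, Real.sqrt (d i) * Real.sqrt (d i) = d i := fun i => Real.mul_self_sqrt (hd i).le
  have q0 : ∀ i, Real.sqrt (d i) ≠ 0 := fun i => (Real.sqrt_pos.2 (hd i)).ne'
  set r : Matrix (Fin n) (Fin n) ℝ := Matrix.diagonal (fun i => Real.sqrt (d i)) with hr
  set s : Matrix (Fin n) (Fin n) ℝ := Matrix.diagonal (fun i => (Real.sqrt (d i))⁻¹) with hs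
  have rt : rᵀ = r := diagonal_transpose _
  have st : sᵀ = s := diagonal_transpose _
  have rs : r * s = 1 := by
    rw [hr, hs, diagonal_mul_diagonal, ← diagonal_one]
    congr 1; ext i; exact mul_inv_cancel₀ (q0 i)
  have rr : r * r = Matrix.diagonal d := by
    rw [hr, diagonal_mul_diagonal]
    congr 1; ext i; exact q i
  have ss : s * Matrix.diagonal (fun i => d i * d i) * s = Matrix.diagonal d := by
    rw [hs, diagonal_mul_diagonal, diagonal_mul_diagonal]
    congr 1; ext i
    have := q i
    have := q0 i
    field_simp
    rw [pow_two, pow_two, q]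
  refine ⟨r * Oᵀ * R⁻¹, R * O * s, ?_, ?_, ?_⟩
  · calc r * Oᵀ * R⁻¹ * (R * O * s) = r * (Oᵀ * ((R⁻¹ * R) * O)) * s := by noncomm_ring
      _ = 1 := by rw [r1, one_mul, hO', mul_one, rs]
  · simp only [transpose_mul, transpose_transpose, rt]
    calc r * Oᵀ * R⁻¹ * (R * Rᵀ) * ((R⁻¹)ᵀ * (O * r))
        = r * (Oᵀ * ((R⁻¹ * R) * ((Rᵀ * (R⁻¹)ᵀ) * O))) * r := by noncomm_ring
      _ = _ := by rw [r1, r2, one_mul, one_mul, hO', mul_one, rr]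
  · simp only [transpose_mul, st]
    calc s * (Oᵀ * Rᵀ) * P * (R * O * s) = s * (Oᵀ * (Rᵀ * P * R) * O) * s := by noncomm_ring
      _ = s * ((Oᵀ * O) * Matrix.diagonal (fun i => d i * d i) * (Oᵀ * O)) * s := by
        rw [hQ]; noncomm_ring
      _ = _ := by rw [hO', one_mul, mul_one, ss]

theorem wx_OmgSq (n : ℕ) : Omg n * Omg n = -1 := by
  rw [Omg, fromBlocks_multiply, ← fromBlocks_one, fromBlocks_neg]
  simp

theorem wx_symp {n : ℕ} (S : Matrix (Fin n ⊕ Fin n) (Fin n ⊕ Fin n) ℝ)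
    (hS : S * Omg n * Sᵀ = Omg n) : Sᵀ * Omg n * S = Omg n := by
  have h0 := wx_OmgSq n
  have h1 : S * (-(Omg n * Sᵀ * Omg n)) = 1 := by
    calc _ = -((S * Omg n * Sᵀ) * Omg n) := by noncomm_ring
      _ = 1 := by rw [hS, h0, neg_neg]
  have h2 := mul_eq_one_comm.1 h1
  calc Sᵀ * Omg n * S = -((Omg n * Omg n) * (Sᵀ * Omg n * S)) := by rw [h0]; noncomm_ring
    _ = Omg n * (-(Omg n * Sᵀ * Omg n) * S) := by noncomm_ring
    _ = Omg n := by rw [h2, mul_one]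

theorem wx_DOmg {n : ℕ} (D : Matrix (Fin n) (Fin n) ℝ) :
    fromBlocks D 0 0 D * Omg n = Omg n * fromBlocks D 0 0 D := by
  rw [Omg, fromBlocks_multiply, fromBlocks_multiply]; simp

theorem wx_K {n : ℕ} (d : Fin n → ℝ) (hd : ∀ i, 0 < d i)
    (K : Matrix (Fin n ⊕ Fin n) (Fin n ⊕ Fin n) ℝ) (hK : K * Omg n * Kᵀ = Omg n)
    (hD : K * fromBlocks (Matrix.diagonal d) 0 0 (Matrix.diagonal d) * Kᵀ
      = fromBlocks (Matrix.diagonal d) 0 0 (Matrix.diagonal d)) :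
    ∃ A B : Matrix (Fin n) (Fin n) ℝ, K = fromBlocks A B (-B) A ∧
      (A * Aᵀ + B * Bᵀ = 1 ∧ B * Aᵀ - A * Bᵀ = 0) ∧
      A * Matrix.diagonal d = Matrix.diagonal d * A ∧
      B * Matrix.diagonal d = Matrix.diagonal d * B := by
  have hK' := wx_symp K hK
  have h0 := wx_OmgSq n
  have hDO := wx_DOmg (Matrix.diagonal d)
  have e : fromBlocks (Matrix.diagonal d) 0 0 (Matrix.diagonal d) =
    Matrix.diagonal (Sum.elim d d) := fromBlocks_diagonal d d
  have hp : ∀ i, 0 < Sum.elim d d i := by rintro (i | i) <;> exact hd i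
  set D := fromBlocks (Matrix.diagonal d) 0 0 (Matrix.diagonal d) with hDdef
  have canc : ∀ Y Z : Matrix (Fin n ⊕ Fin n) (Fin n ⊕ Fin n) ℝ, D * Y = D * Z → Y = Z := by
    intro Y Z h
    ext i j
    have := congrFun (congrFun h i) j
    rw [e, diagonal_mul, diagonal_mul] at this
    exact mul_left_cancel₀ (hp i).ne' this
  have g : K * (D * Omg n) = (D * Omg n) * K := by
    calc K * (D * Omg n) = K * D * (Kᵀ * Omg n * K) := by rw [hK']; noncomm_ring
      _ = (K * D * Kᵀ) * Omg n * K := by noncomm_ring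
      _ = _ := by rw [hD]
  have gg : (D * Omg n) * (D * Omg n) = -(D * D) := by
    calc (D * Omg n) * (D * Omg n) = D * (Omg n * D) * Omg n := by noncomm_ring
      _ = D * D * (Omg n * Omg n) := by rw [← hDO]; noncomm_ring
      _ = _ := by rw [h0]; noncomm_ring
  have kd2 : K * (D * D) = (D * D) * K := by
    have : K * ((D * Omg n) * (D * Omg n)) = ((D * Omg n) * (D * Omg n)) * K := by
      rw [← mul_assoc, g, mul_assoc, g, ← mul_assoc]
    rw [gg] at this
    simpa using this
  have kd : K * D = D * K := by
    ext i j
    have := congrFun (congrFun kd2 i) j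
    rw [e, diagonal_mul_diagonal, diagonal_mul, mul_diagonal] at this
    rw [e, diagonal_mul, mul_diagonal]
    have h1 := hp i
    have h2 := hp j
    have h3 : (Sum.elim d d j - Sum.elim d d i) * K i j = 0 := by
      have : (Sum.elim d d j + Sum.elim d d i) * ((Sum.elim d d j - Sum.elim d d i) * K i j) = 0 := by
        linear_combination this
      exact (mul_eq_zero.1 this).resolve_left (by positivity)
    linear_combination h3
  have kk : K * Kᵀ = 1 := by
    apply canc
    rw [← mul_assoc, ← kd, hD, mul_one]
  have ko : K * Omg n = Omg n * K := by
    apply canc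
    rw [← mul_assoc, ← kd, mul_assoc, g, mul_assoc]
  rw [← fromBlocks_toBlocks K] at ko kk kd ⊢
  generalize K.toBlocks₁₁ = a at *
  generalize K.toBlocks₁₂ = b at *
  generalize K.toBlocks₂₁ = c at *
  generalize K.toBlocks₂₂ = f at *
  simp only [Omg, fromBlocks_multiply, fromBlocks_inj, mul_zero, zero_mul, mul_one, one_mul,
    mul_neg, neg_mul, zero_add, add_zero] at ko
  obtain ⟨k1, k2, -, -⟩ := ko
  subst k1 k2
  refine ⟨a, b, by simp, ?_, ?_⟩
  · rw [fromBlocks_transpose, fromBlocks_multiply, ← fromBlocks_one, fromBlocks_inj] at kk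
    refine ⟨kk.1, ?_⟩
    rw [← kk.2.1]
    simp [sub_eq_add_neg, add_comm]
  · rw [hDdef, fromBlocks_multiply, fromBlocks_multiply, fromBlocks_inj] at kd
    exact ⟨by simpa using kd.1, by simpa using kd.2.1⟩

/-- Classification of symplectic matrices `S` such that `S [[D,0],[0,D]] Sᵀ` is in
xp-form: this happens iff `S = [[M⁻¹,0],[0,Mᵀ]] · H [[U,0],[0,U*]] H†` with `M` real
invertible and `U` a unitary commuting with `D`. -/
theorem williamson_xp_classification {n : ℕ} (d : Fin n → ℝ) (hd : ∀ i, 0 < d i)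
    (S : Matrix (Fin n ⊕ Fin n) (Fin n ⊕ Fin n) ℝ)
    (hS : S * Omg n * Sᵀ = Omg n) :
    ((S * fromBlocks (Matrix.diagonal d) 0 0 (Matrix.diagonal d) * Sᵀ).toBlocks₁₂ = 0 ∧
     (S * fromBlocks (Matrix.diagonal d) 0 0 (Matrix.diagonal d) * Sᵀ).toBlocks₂₁ = 0) ↔
    ∃ (M : Matrix (Fin n) (Fin n) ℝ) (U : Matrix (Fin n) (Fin n) ℂ),
      IsUnit M.det ∧ U ∈ Matrix.unitaryGroup (Fin n) ℂ ∧
      U * (Matrix.diagonal d).map Complex.ofReal = (Matrix.diagonal d).map Complex.ofReal * U ∧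
      S.map Complex.ofReal =
        (fromBlocks M⁻¹ 0 0 Mᵀ).map Complex.ofReal *
          (Hmat n * fromBlocks U 0 0 (U.map (starRingEnd ℂ)) * (Hmat n)ᴴ) := by
  constructor
  · rintro ⟨h12, h21⟩
    have hS' := wx_symp S hS
    have h0 := wx_OmgSq n
    have hDO := wx_DOmg (Matrix.diagonal d)
    have hSdet : IsUnit S := by
      have h1 : S * (-(Omg n * Sᵀ * Omg n)) = 1 := by
        calc _ = -((S * Omg n * Sᵀ) * Omg n) := by noncomm_ring
          _ = 1 := by rw [hS, h0, neg_neg]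
      exact IsUnit.of_mul_eq_one _ h1
    have hpd : (S * fromBlocks (Matrix.diagonal d) 0 0 (Matrix.diagonal d) * Sᵀ).PosDef := by
      rw [← conjTranspose_eq_transpose_of_trivial S]
      refine Matrix.PosDef.mul_mul_conjTranspose_same ?_ (vecMul_injective_of_isUnit hSdet)
      rw [fromBlocks_diagonal]
      refine Matrix.PosDef.diagonal ?_
      rintro (i | i) <;> exact hd i
    have hV := (fromBlocks_toBlocks
      (S * fromBlocks (Matrix.diagonal d) 0 0 (Matrix.diagonal d) * Sᵀ)).symm
    rw [h12, h21] at hV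
    have hX : (S * fromBlocks (Matrix.diagonal d) 0 0 (Matrix.diagonal d) * Sᵀ).toBlocks₁₁.PosDef :=
      hpd.submatrix Sum.inl_injective
    have hP : (S * fromBlocks (Matrix.diagonal d) 0 0 (Matrix.diagonal d) * Sᵀ).toBlocks₂₂.PosDef :=
      hpd.submatrix Sum.inr_injective
    have hPt := hP.isHermitian.eq
    rw [conjTranspose_eq_transpose_of_trivial] at hPt
    clear hpd h12 h21 hP
    generalize (S * fromBlocks (Matrix.diagonal d) 0 0 (Matrix.diagonal d) * Sᵀ).toBlocks₁₁ = X at *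
    generalize (S * fromBlocks (Matrix.diagonal d) 0 0 (Matrix.diagonal d) * Sᵀ).toBlocks₂₂ = P at *
    have hc : (P * X).charpoly = (Matrix.diagonal (fun i => d i * d i)).charpoly := by
      apply wx_charpoly P X _ (-(Omg n * S * Omg n)) Sᵀ
      · calc Sᵀ * -(Omg n * S * Omg n) = -((Sᵀ * Omg n * S) * Omg n) := by noncomm_ring
          _ = 1 := by rw [hS', h0, neg_neg]
      · have e1 : fromBlocks (P * X) 0 0 (X * P) =
            -((Omg n * fromBlocks X 0 0 P) * (Omg n * fromBlocks X 0 0 P)) := by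
          simp [Omg, fromBlocks_multiply, fromBlocks_neg]
        have e2 : fromBlocks (Matrix.diagonal (fun i => d i * d i)) 0 0
            (Matrix.diagonal (fun i => d i * d i)) =
            fromBlocks (Matrix.diagonal d) 0 0 (Matrix.diagonal d) *
            fromBlocks (Matrix.diagonal d) 0 0 (Matrix.diagonal d) := by
          simp [fromBlocks_multiply]
        rw [e1, e2, ← hV]
        generalize fromBlocks (Matrix.diagonal d) 0 0 (Matrix.diagonal d) = D at *
        calc -(Omg n * (S * D * Sᵀ) * (Omg n * (S * D * Sᵀ)))
            = -(Omg n * S * D * (Sᵀ * Omg n * S) * D * Sᵀ) := by noncomm_ring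
          _ = -(Omg n * S * (D * Omg n) * D * Sᵀ) := by rw [hS']; noncomm_ring
          _ = _ := by rw [hDO]; noncomm_ring
    obtain ⟨M, N, hMN, hM, hN⟩ := wx_M d hd X P hX hPt hc
    have hNM : N * M = 1 := mul_eq_one_comm.1 hMN
    have hMNt : Nᵀ * Mᵀ = 1 := by rw [← transpose_mul, hMN, transpose_one]
    have hNMt : Mᵀ * Nᵀ = 1 := by rw [← transpose_mul, hNM, transpose_one]
    obtain ⟨A, B, hK, hU, hA, hB⟩ := wx_K d hd (fromBlocks M 0 0 Nᵀ * S)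
      (by
        calc fromBlocks M 0 0 Nᵀ * S * Omg n * (fromBlocks M 0 0 Nᵀ * S)ᵀ
            = fromBlocks M 0 0 Nᵀ * (S * Omg n * Sᵀ) * (fromBlocks M 0 0 Nᵀ)ᵀ := by
              rw [transpose_mul]; noncomm_ring
          _ = _ := by
            rw [hS, Omg, fromBlocks_transpose, fromBlocks_multiply, fromBlocks_multiply]
            simp [hMN, hMNt])
      (by
        calc fromBlocks M 0 0 Nᵀ * S * fromBlocks (Matrix.diagonal d) 0 0 (Matrix.diagonal d) *
              (fromBlocks M 0 0 Nᵀ * S)ᵀ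
            = fromBlocks M 0 0 Nᵀ * (S * fromBlocks (Matrix.diagonal d) 0 0 (Matrix.diagonal d) *
              Sᵀ) * (fromBlocks M 0 0 Nᵀ)ᵀ := by
              rw [transpose_mul]; noncomm_ring
          _ = _ := by
            rw [hV, fromBlocks_transpose, fromBlocks_multiply, fromBlocks_multiply]
            simp [hM, hN])
    refine ⟨M, A.map Complex.ofReal + Complex.I • B.map Complex.ofReal, ?_, (wx_U A B).2 hU,
      (wx_comm A B _).2 ⟨hA, hB⟩, ?_⟩
    · rw [← isUnit_iff_isUnit_det]
      exact IsUnit.of_mul_eq_one _ hMN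
    · rw [wx_H, ← hK, inv_eq_right_inv hMN]
      have e : S = fromBlocks N 0 0 Mᵀ * (fromBlocks M 0 0 Nᵀ * S) := by
        rw [← mul_assoc, fromBlocks_multiply]
        simp [hNM, hNMt]
      conv_lhs => rw [e]
      exact Matrix.map_mul (f := Complex.ofRealHom)
  · rintro ⟨M, U, hM, hU, hc, hSe⟩
    obtain ⟨A, B, rfl⟩ : ∃ A B : Matrix (Fin n) (Fin n) ℝ,
        U = A.map Complex.ofReal + Complex.I • B.map Complex.ofReal := by
      refine ⟨U.map Complex.re, U.map Complex.im, ?_⟩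
      ext i j
      simp [mul_comm Complex.I]
    rw [wx_U] at hU
    rw [wx_comm] at hc
    obtain ⟨hA, hB⟩ := hc
    rw [wx_H] at hSe
    have e : S = fromBlocks M⁻¹ 0 0 Mᵀ * fromBlocks A B (-B) A := by
      apply Matrix.map_injective Complex.ofReal_injective
      exact hSe.trans (Matrix.map_mul (f := Complex.ofRealHom)).symm
    have z : B * Matrix.diagonal d * Aᵀ - A * Matrix.diagonal d * Bᵀ = 0 := by
      rw [hA, hB, mul_assoc, mul_assoc, ← mul_sub, hU.2, mul_zero]
    have z' : A * Matrix.diagonal d * Bᵀ - B * Matrix.diagonal d * Aᵀ = 0 := by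
      rw [← neg_sub, z, neg_zero]
    rw [e, transpose_mul, fromBlocks_transpose, fromBlocks_transpose]
    simp only [fromBlocks_multiply, toBlocks_fromBlocks₁₂, toBlocks_fromBlocks₂₁, mul_zero,
      zero_mul, add_zero, zero_add, transpose_zero, transpose_transpose, transpose_neg]
    constructor
    · calc _ = M⁻¹ * (B * Matrix.diagonal d * Aᵀ - A * Matrix.diagonal d * Bᵀ) * M := by
            noncomm_ring
        _ = 0 := by rw [z]; simp
    · calc _ = Mᵀ * (A * Matrix.diagonal d * Bᵀ - B * Matrix.diagonal d * Aᵀ) * (M⁻¹)ᵀ := by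
            noncomm_ring
        _ = 0 := by rw [z']; simp
end
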